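/- arXiv:0811.2475 — 2 statements merged into one kernel-verified Lean document; each statement's English description precedes it below -/
import Mathlib

section
/- Let X be a finite nonempty set and let A ∈ ℂ^{X×X} be a type II matrix. If M, N ∈ N_A (the Nomura algebra of A), then: (i) Θ_A(M) ∈ N_{Aᵀ}; (ii) Θ_{Aᵀ}(Θ_A(M)) = |X| · Mᵀ; and (iii) MN ∈ N_A with Θ_A(MN) = Θ_A(M) ∘ Θ_A(N), where ∘ is the entrywise (Hadamard) product. -/
open Matrix BigOperators

namespace TypeII

variable {X : Type*} [Fintype X] [DecidableEq X]

/-- The Schur inverse of a nowhere-zero matrix. -/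
noncomputable def schurInv (A : Matrix X X ℂ) : Matrix X X ℂ :=
  Matrix.of fun x y => (A x y)⁻¹

/-- `A` is a type II matrix. -/
def IsTypeII (A : Matrix X X ℂ) : Prop :=
  (∀ x y, A x y ≠ 0) ∧ A * (schurInv A)ᵀ = (Fintype.card X : ℂ) • (1 : Matrix X X ℂ)

/-- The vector `u_{xy}` : the entrywise product of column `x` of `A` and column `y`
of the Schur inverse of `A`. -/
noncomputable def uVec (A : Matrix X X ℂ) (x y : X) : X → ℂ :=
  fun z => A z x * (A z y)⁻¹

/-- `M` belongs to the Nomura algebra of `A`, with eigenvalue matrix `Θ`: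
`M u_{xy} = Θ_{xy} u_{xy}` for all `x, y`. -/
def IsNomura (A M Θ : Matrix X X ℂ) : Prop :=
  ∀ x y, M.mulVec (uVec A x y) = Θ x y • uVec A x y

theorem key (A : Matrix X X ℂ) (hA : IsTypeII A)
    (M ΘM : Matrix X X ℂ) (hM : IsNomura A M ΘM) :
    IsNomura Aᵀ ΘM ((Fintype.card X : ℂ) • Mᵀ) := by
  obtain ⟨h0, h2⟩ := hA
  intro a b
  funext x
  have horth : ∀ c, ∑ y, A a y * (A c y)⁻¹ = if a = c then (Fintype.card X : ℂ) else 0 := by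
    intro c
    have h := congrFun (congrFun h2 a) c
    simpa [Matrix.mul_apply, schurInv, Matrix.one_apply] using h
  have hstep : ∀ y, ΘM x y * (A a y * (A b y)⁻¹)
      = ∑ c, M b c * (A c x * (A b x)⁻¹) * (A a y * (A c y)⁻¹) := by
    intro y
    have h := congrFun (hM x y) b
    simp only [Matrix.mulVec, dotProduct, uVec, Pi.smul_apply, smul_eq_mul] at h
    have hb := h0 b x
    calc ΘM x y * (A a y * (A b y)⁻¹)
        = (ΘM x y * (A b x * (A b y)⁻¹)) * (A a y * (A b x)⁻¹) := by
          field_simp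
      _ = _ := by
          rw [← h, Finset.sum_mul]
          refine Finset.sum_congr rfl fun c _ => ?_
          ring
  simp only [Matrix.mulVec, dotProduct, uVec, Pi.smul_apply, smul_eq_mul, Matrix.transpose_apply,
    Matrix.smul_apply]
  simp_rw [hstep]
  rw [Finset.sum_comm]
  simp_rw [← Finset.mul_sum, horth]
  simp
  ring

/-- Jaeger–Matsumoto–Nomura: for a type II matrix `A` and
`M, N ∈ N_A` with `Θ_A(M) = ΘM`, `Θ_A(N) = ΘN`:
(i) `ΘM ∈ N_{Aᵀ}`; (ii) `Θ_{Aᵀ}(Θ_A(M)) = |X| Mᵀ`; (iii) `MN ∈ N_A` with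
`Θ_A(MN) = Θ_A(M) ∘ Θ_A(N)` (Hadamard product). -/
theorem nomura_duality [Nonempty X] (A : Matrix X X ℂ) (hA : IsTypeII A)
    (M N ΘM ΘN : Matrix X X ℂ) (hM : IsNomura A M ΘM) (hN : IsNomura A N ΘN) :
    (∀ x y, ∃ c : ℂ, ΘM.mulVec (uVec Aᵀ x y) = c • uVec Aᵀ x y) ∧
      (∀ Θ' : Matrix X X ℂ, IsNomura Aᵀ ΘM Θ' → Θ' = (Fintype.card X : ℂ) • Mᵀ) ∧
      IsNomura A (M * N) (Matrix.hadamard ΘM ΘN) := by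
  have hk := key A hA M ΘM hM
  refine ⟨fun x y => ⟨_, hk x y⟩, ?_, ?_⟩
  · intro Θ' h'
    ext a b
    obtain ⟨z⟩ := ‹Nonempty X›
    have h := congrFun ((h' a b).symm.trans (hk a b)) z
    simp only [Pi.smul_apply, smul_eq_mul] at h
    refine mul_right_cancel₀ ?_ h
    exact mul_ne_zero (hA.1 _ _) (inv_ne_zero (hA.1 _ _))
  · intro x y
    rw [← Matrix.mulVec_mulVec, hN x y, Matrix.mulVec_smul, hM x y, smul_smul,
      Matrix.hadamard_apply, mul_comm]

end TypeII
end

section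
/- Let Y ⊆ {0,1}^n be a nonempty binary code (n ≥ 1) and let λ_{ijk} (0 ≤ i,j,k ≤ n) be defined from Y as in the context. Then: (i) λ_{000} = 1; (ii) 0 ≤ λ_{ijk} ≤ λ_{0jj} for all i, j, k; (iii) λ_{ijk} = λ_{i'j'k'} whenever (i',j',k') is a permutation of (i,j,k); (iv) the matrices Σ_{i,j,k} λ_{ijk} E_i* A_j E_k* and Σ_{i,j,k} (λ_{0jj} − λ_{ijk}) E_i* A_j E_k* are positive semidefinite; (v) if Y has minimum Hamming distance at least δ, then λ_{ijk} = 0 whenever {i,j,k} ∩ {1,…,δ−1} ≠ ∅; and (vi) Σ_{i=0}^n C(n,i) λ_{0ii} = |Y|. Consequently, every binary code of length n and minimum distance at least δ has size at most the optimum value ℓ_SDP of Schrijver's semidefinite program with constraints (i)–(v) and objective Σ_i C(n,i) λ_{0ii}. -/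
open Matrix BigOperators Finset

namespace SDPBound

/-- The vertex set of the binary Hamming scheme `H(n,2)`. -/
abbrev BX (n : ℕ) := Fin n → Fin 2

/-- The adjacency matrix `A_j` of the distance-`j` relation of `H(n,2)`. -/
noncomputable def Aham (n : ℕ) (j : ℕ) : Matrix (BX n) (BX n) ℝ :=
  Matrix.of fun x y => if hammingDist x y = j then 1 else 0

/-- The diagonal matrix `E_i*` cutting out the words of Hamming weight `i`. -/
noncomputable def Estar (n : ℕ) (i : ℕ) : Matrix (BX n) (BX n) ℝ :=
  Matrix.diagonal fun y => if hammingDist y 0 = i then 1 else 0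

/-- The number of triples `(y,y',y'') ∈ Y³` with prescribed pairwise distances. -/
noncomputable def NT {n : ℕ} (Y : Finset (BX n)) (i j k : ℕ) : ℕ :=
  ((Y ×ˢ Y ×ˢ Y).filter fun t =>
    hammingDist t.1 t.2.1 = i ∧ hammingDist t.2.1 t.2.2 = j ∧
      hammingDist t.2.2 t.1 = k).card

/-- Schrijver's variables `λ_{ijk}` attached to the code `Y`. -/
noncomputable def lam {n : ℕ} (Y : Finset (BX n)) (i j k : ℕ) : ℝ :=
  if NT (Finset.univ : Finset (BX n)) i j k ≠ 0 then
    ((2 : ℝ) ^ n / Y.card) * (NT Y i j k : ℝ) / (NT (Finset.univ : Finset (BX n)) i j k : ℝ)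
  else 0

/-- Feasibility for Schrijver's semidefinite program for binary codes with minimum
distance `δ`. -/
noncomputable def Feasible (n δ : ℕ) (μ : ℕ → ℕ → ℕ → ℝ) : Prop :=
  μ 0 0 0 = 1 ∧
  (∀ i j k, i ≤ n → j ≤ n → k ≤ n → 0 ≤ μ i j k ∧ μ i j k ≤ μ 0 j j) ∧
  (∀ i j k, μ i j k = μ j i k ∧ μ i j k = μ i k j) ∧
  (∑ i ∈ range (n + 1), ∑ j ∈ range (n + 1), ∑ k ∈ range (n + 1),
      μ i j k • (Estar n i * Aham n j * Estar n k)).PosSemidef ∧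
  (∑ i ∈ range (n + 1), ∑ j ∈ range (n + 1), ∑ k ∈ range (n + 1),
      (μ 0 j j - μ i j k) • (Estar n i * Aham n j * Estar n k)).PosSemidef ∧
  (∀ i j k, ((1 ≤ i ∧ i ≤ δ - 1) ∨ (1 ≤ j ∧ j ≤ δ - 1) ∨ (1 ≤ k ∧ k ≤ δ - 1)) →
    μ i j k = 0)

/-- The isometry group of the Hamming cube. -/
def Iso (n : ℕ) : Subgroup (Equiv.Perm (BX n)) where
  carrier := {g | ∀ x y, hammingDist (g x) (g y) = hammingDist x y}
  mul_mem' := by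
    intro a b ha hb x y
    simp only [Set.mem_ofPred_eq] at ha hb
    simp [Equiv.Perm.mul_apply, ha, hb]
  one_mem' := by intro x y; rfl
  inv_mem' := by
    intro a ha x y
    simp only [Set.mem_ofPred_eq] at ha
    have := ha (a⁻¹ x) (a⁻¹ y)
    simpa using this.symm

noncomputable instance (n : ℕ) : Fintype (Iso n) := Fintype.ofFinite _

theorem fiber_card {n : ℕ} (P Q P' Q' : Fin n → Bool)
    (h1 : #{i | P i = true} = #{i | P' i = true})
    (h2 : #{i | Q i = true} = #{i | Q' i = true})
    (h3 : #{i | P i ≠ Q i} = #{i | P' i ≠ Q' i}) (p q : Bool) :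
    #{i | P i = p ∧ Q i = q} = #{i | P' i = p ∧ Q' i = q} := by
  have key : ∀ P Q : Fin n → Bool,
      #{i | P i = true} = #{i | P i = true ∧ Q i = true} + #{i | P i = true ∧ Q i = false} ∧
      #{i | Q i = true} = #{i | P i = true ∧ Q i = true} + #{i | P i = false ∧ Q i = true} ∧
      #{i | P i ≠ Q i} = #{i | P i = true ∧ Q i = false} + #{i | P i = false ∧ Q i = true} ∧
      n = #{i | P i = true ∧ Q i = true} + #{i | P i = false ∧ Q i = true}
        + #{i | P i = true ∧ Q i = false} + #{i | P i = false ∧ Q i = false} := by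
    intro P Q
    have hn : n = ∑ i : Fin n, 1 := by simp
    refine ⟨?_, ?_, ?_, hn.trans ?_⟩ <;>
      simp only [Finset.card_filter, ← Finset.sum_add_distrib] <;>
      refine Finset.sum_congr rfl fun i _ => ?_ <;>
      cases P i <;> cases Q i <;> simp
  have a := key P Q
  have b := key P' Q'
  cases p <;> cases q <;> omega

theorem trans_triple {n : ℕ} (a b c a' b' c' : BX n)
    (h1 : hammingDist a b = hammingDist a' b') (h2 : hammingDist b c = hammingDist b' c')
    (h3 : hammingDist c a = hammingDist c' a') :
    ∃ g : Iso n, g.1 a = a' ∧ g.1 b = b' ∧ g.1 c = c' := by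
  classical
  have hf := fiber_card (fun i => decide (a i ≠ b i)) (fun i => decide (c i ≠ a i))
    (fun i => decide (a' i ≠ b' i)) (fun i => decide (c' i ≠ a' i))
    (by simpa [hammingDist] using h1) (by simpa [hammingDist] using h3)
    (by
      have aux : ∀ u v w : Fin 2, (decide (u ≠ v) ≠ decide (w ≠ u)) ↔ v ≠ w := by decide
      simp only [aux]
      exact h2)
  let f : Fin n → Bool × Bool := fun i => (decide (a i ≠ b i), decide (c i ≠ a i))
  let f' : Fin n → Bool × Bool := fun i => (decide (a' i ≠ b' i), decide (c' i ≠ a' i))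
  have hc : ∀ r : Bool × Bool, Nonempty ({i // f' i = r} ≃ {i // f i = r}) := by
    rintro ⟨p, q⟩
    refine ⟨Fintype.equivOfCardEq ?_⟩
    rw [Fintype.card_subtype, Fintype.card_subtype]
    have := (hf p q).symm
    simpa only [f, f', Prod.mk.injEq] using this
  let σ : Fin n ≃ Fin n := Equiv.ofFiberEquiv fun r => (hc r).some
  have hσ : ∀ i, f (σ i) = f' i := fun i => Equiv.ofFiberEquiv_map _ i
  let g : Equiv.Perm (BX n) :=
    (Equiv.arrowCongr σ.symm (Equiv.refl _)).trans (Equiv.addRight (fun i => a (σ i) + a' i))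
  have hg : ∀ x i, g x i = x (σ i) + (a (σ i) + a' i) := by intro x i; rfl
  refine ⟨⟨g, ?_⟩, ?_, ?_, ?_⟩
  · intro x y
    simp only [hammingDist, hg]
    refine Finset.card_bij (fun i _ => σ i) ?_ ?_ ?_
    · intro i hi; simpa using hi
    · intro i _ j _ h; exact σ.injective h
    · intro i hi; exact ⟨σ.symm i, by simpa using hi, by simp⟩
  · funext i
    have aux : ∀ u v : Fin 2, u + (u + v) = v := by decide
    exact (hg a i).trans (aux _ _)
  · funext i
    have aux : ∀ u v u' v' : Fin 2, decide (u ≠ v) = decide (u' ≠ v') →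
      v + (u + u') = v' := by decide
    exact (hg b i).trans (aux _ _ _ _ (congrArg Prod.fst (hσ i)))
  · funext i
    have aux : ∀ u v u' v' : Fin 2, decide (v ≠ u) = decide (v' ≠ u') →
      v + (u + u') = v' := by decide
    exact (hg c i).trans (aux _ _ _ _ (congrArg Prod.snd (hσ i)))

/-- Indicator of the code. -/
noncomputable def ind {n : ℕ} (Y : Finset (BX n)) (x : BX n) : ℝ := if x ∈ Y then 1 else 0

theorem ind_nonneg {n : ℕ} (Y : Finset (BX n)) (x : BX n) : 0 ≤ ind Y x := by
  unfold ind; split_ifs <;> norm_num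

theorem ind_le {n : ℕ} (Y : Finset (BX n)) (x : BX n) : ind Y x ≤ 1 := by
  unfold ind; split_ifs <;> norm_num

theorem ind_sq {n : ℕ} (Y : Finset (BX n)) (x : BX n) : ind Y x * ind Y x = ind Y x := by
  unfold ind; split_ifs <;> norm_num

/-- Orbit sum. -/
noncomputable def S {n : ℕ} (Y : Finset (BX n)) (a b c : BX n) : ℝ :=
  ∑ g : Iso n, ind Y (g.1 a) * ind Y (g.1 b) * ind Y (g.1 c)

theorem S_mul {n : ℕ} (Y : Finset (BX n)) (a b c : BX n) (h : Iso n) :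
    S Y (h.1 a) (h.1 b) (h.1 c) = S Y a b c := by
  unfold S
  exact Fintype.sum_equiv (Equiv.mulRight h) _ _ (fun g => rfl)

/-- Triples of a given type. -/
noncomputable def TT (n i j k : ℕ) : Finset (BX n × BX n × BX n) :=
  Finset.univ.filter fun t =>
    hammingDist t.1 t.2.1 = i ∧ hammingDist t.2.1 t.2.2 = j ∧ hammingDist t.2.2 t.1 = k

theorem NT_univ (n i j k : ℕ) : NT (Finset.univ : Finset (BX n)) i j k = #(TT n i j k) := by
  unfold NT TT; simp

theorem NT_sum {n : ℕ} (Y : Finset (BX n)) (i j k : ℕ) :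
    (NT Y i j k : ℝ) = ∑ t ∈ TT n i j k, ind Y t.1 * ind Y t.2.1 * ind Y t.2.2 := by
  unfold NT TT ind
  rw [Finset.card_filter, Finset.sum_filter]
  push_cast
  rw [← Finset.sum_subset (Finset.subset_univ (Y ×ˢ Y ×ˢ Y))]
  · refine Finset.sum_congr rfl fun t ht => ?_
    simp only [Finset.mem_product] at ht
    simp [ht]
  · intro t _ ht
    simp only [Finset.mem_product] at ht
    split_ifs <;> simp_all

theorem count {n : ℕ} (Y : Finset (BX n)) (a b c : BX n) :
    (#(TT n (hammingDist a b) (hammingDist b c) (hammingDist c a)) : ℝ) * S Y a b c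
      = Fintype.card (Iso n) * NT Y (hammingDist a b) (hammingDist b c) (hammingDist c a) := by
  set i := hammingDist a b with hi
  set j := hammingDist b c with hj
  set k := hammingDist c a with hk
  have h1 : ∀ t ∈ TT n i j k, S Y t.1 t.2.1 t.2.2 = S Y a b c := by
    intro t ht
    simp only [TT, Finset.mem_filter] at ht
    obtain ⟨g, g1, g2, g3⟩ := trans_triple a b c t.1 t.2.1 t.2.2
      (hi.symm.trans ht.2.1.symm) (hj.symm.trans ht.2.2.1.symm) (hk.symm.trans ht.2.2.2.symm)
    rw [← g1, ← g2, ← g3, S_mul]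
  rw [← nsmul_eq_mul, ← Finset.sum_const, ← Finset.sum_congr rfl h1]
  unfold S
  rw [Finset.sum_comm]
  have h2 : ∀ g : Iso n, ∑ t ∈ TT n i j k,
      ind Y (g.1 t.1) * ind Y (g.1 t.2.1) * ind Y (g.1 t.2.2) = NT Y i j k := by
    intro g
    rw [NT_sum]
    refine Finset.sum_equiv (Equiv.prodCongr g.1 (Equiv.prodCongr g.1 g.1)) ?_ ?_
    · intro t
      have := g.2
      simp only [TT, Finset.mem_filter, Finset.mem_univ, true_and, Equiv.prodCongr_apply,
        Prod.map_fst, Prod.map_snd, this _ _]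
    · intro t _; rfl
  rw [Finset.sum_congr rfl fun g _ => h2 g]
  simp

theorem lam_eq {n : ℕ} (Y : Finset (BX n)) (a b c : BX n) :
    lam Y (hammingDist a b) (hammingDist b c) (hammingDist c a)
      = ((2 : ℝ) ^ n / Y.card / Fintype.card (Iso n)) * S Y a b c := by
  have h := count Y a b c
  have hT : #(TT n (hammingDist a b) (hammingDist b c) (hammingDist c a)) ≠ 0 :=
    Finset.card_ne_zero_of_mem (a := (a, b, c)) (by simp [TT])
  have hG : (Fintype.card (Iso n) : ℝ) ≠ 0 := by exact_mod_cast Fintype.card_ne_zero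
  unfold lam
  rw [NT_univ, if_pos hT]
  have hT' : (#(TT n (hammingDist a b) (hammingDist b c) (hammingDist c a)) : ℝ) ≠ 0 := by
    exact_mod_cast hT
  rw [div_eq_iff hT', mul_assoc, mul_comm (S Y a b c), h]
  field_simp

theorem lam_eq0 {n : ℕ} (Y : Finset (BX n)) (b c : BX n) :
    lam Y 0 (hammingDist b c) (hammingDist b c)
      = ((2 : ℝ) ^ n / Y.card / Fintype.card (Iso n)) *
        ∑ g : Iso n, ind Y (g.1 b) * ind Y (g.1 c) := by
  have := lam_eq Y b b c
  rw [hammingDist_self, hammingDist_comm c b] at this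
  rw [this]
  unfold S
  simp only [ind_sq]

theorem const_nonneg {n : ℕ} (Y : Finset (BX n)) :
    0 ≤ (2 : ℝ) ^ n / Y.card / Fintype.card (Iso n) := by positivity

theorem lam_nonneg {n : ℕ} (Y : Finset (BX n)) (i j k : ℕ) : 0 ≤ lam Y i j k := by
  unfold lam; split_ifs <;> positivity

theorem lam_le {n : ℕ} (Y : Finset (BX n)) (i j k : ℕ) : lam Y i j k ≤ lam Y 0 j j := by
  by_cases h : NT (Finset.univ : Finset (BX n)) i j k = 0
  · have : lam Y i j k = 0 := by simp [lam, h]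
    rw [this]; exact lam_nonneg _ _ _ _
  · rw [NT_univ] at h
    obtain ⟨⟨a, b, c⟩, ht⟩ := Finset.card_pos.1 (Nat.pos_of_ne_zero h)
    simp only [TT, Finset.mem_filter, Finset.mem_univ, true_and] at ht
    obtain ⟨rfl, rfl, rfl⟩ := ht
    rw [lam_eq, lam_eq0]
    refine mul_le_mul_of_nonneg_left (Finset.sum_le_sum fun g _ => ?_) (const_nonneg Y)
    rw [mul_assoc]
    exact mul_le_of_le_one_left (mul_nonneg (ind_nonneg _ _) (ind_nonneg _ _)) (ind_le _ _)

theorem NT_symm1 {n : ℕ} (Y : Finset (BX n)) (i j k : ℕ) : NT Y i j k = NT Y j i k := by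
  unfold NT
  refine Finset.card_nbij' (fun t => (t.2.2, t.2.1, t.1)) (fun t => (t.2.2, t.2.1, t.1)) ?_ ?_ ?_ ?_
  · rintro ⟨a, b, c⟩ h
    simp only [Finset.coe_filter, Finset.mem_product, Set.mem_ofPred_eq] at h ⊢
    rw [hammingDist_comm c b, hammingDist_comm b a, hammingDist_comm a c]; tauto
  · rintro ⟨a, b, c⟩ h
    simp only [Finset.coe_filter, Finset.mem_product, Set.mem_ofPred_eq] at h ⊢
    rw [hammingDist_comm c b, hammingDist_comm b a, hammingDist_comm a c]; tauto
  · intro t _; rfl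
  · intro t _; rfl

theorem NT_symm2 {n : ℕ} (Y : Finset (BX n)) (i j k : ℕ) : NT Y i j k = NT Y i k j := by
  unfold NT
  refine Finset.card_nbij' (fun t => (t.2.1, t.1, t.2.2)) (fun t => (t.2.1, t.1, t.2.2)) ?_ ?_ ?_ ?_
  · rintro ⟨a, b, c⟩ h
    simp only [Finset.coe_filter, Finset.mem_product, Set.mem_ofPred_eq] at h ⊢
    rw [hammingDist_comm c b, hammingDist_comm b a, hammingDist_comm a c]; tauto
  · rintro ⟨a, b, c⟩ h
    simp only [Finset.coe_filter, Finset.mem_product, Set.mem_ofPred_eq] at h ⊢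
    rw [hammingDist_comm c b, hammingDist_comm b a, hammingDist_comm a c]; tauto
  · intro t _; rfl
  · intro t _; rfl

theorem lam_symm {n : ℕ} (Y : Finset (BX n)) (i j k : ℕ) :
    lam Y i j k = lam Y j i k ∧ lam Y i j k = lam Y i k j := by
  constructor
  · unfold lam; rw [NT_symm1 Y i j k, NT_symm1 univ i j k]
  · unfold lam; rw [NT_symm2 Y i j k, NT_symm2 univ i j k]

theorem entry (n : ℕ) (f : ℕ → ℕ → ℕ → ℝ) (x y : BX n) :
    (∑ i ∈ range (n + 1), ∑ j ∈ range (n + 1), ∑ k ∈ range (n + 1),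
      f i j k • (Estar n i * Aham n j * Estar n k)) x y
      = f (hammingDist x 0) (hammingDist x y) (hammingDist y 0) := by
  have hle : ∀ u v : BX n, hammingDist u v ∈ range (n + 1) := by
    intro u v
    have := hammingDist_le_card_fintype (x := u) (y := v)
    simp only [Fintype.card_fin] at this
    exact Finset.mem_range.2 (by omega)
  simp only [Matrix.sum_apply, Matrix.smul_apply, Estar, Aham, Matrix.mul_diagonal,
    Matrix.diagonal_mul, Matrix.of_apply, smul_eq_mul]
  rw [Finset.sum_eq_single_of_mem _ (hle x 0), Finset.sum_eq_single_of_mem _ (hle x y),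
    Finset.sum_eq_single_of_mem _ (hle y 0)]
  · simp
  · intro k _ hk; simp [-hammingDist_zero_right, hk.symm]
  · intro k _ hk; simp [-hammingDist_zero_right, hk.symm]
  · intro k _ hk; simp [-hammingDist_zero_right, hk.symm]

theorem psd_aux {n : ℕ} (M : Matrix (BX n) (BX n) ℝ) (c : ℝ) (hc : 0 ≤ c) (w : Iso n → ℝ)
    (hw : ∀ g, 0 ≤ w g) (u : Iso n → BX n → ℝ)
    (h : ∀ x y, M x y = c * ∑ g, w g * (u g x * u g y)) : M.PosSemidef := by
  have : M = c • ∑ g, w g • Matrix.vecMulVec (u g) (star (u g)) := by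
    ext x y
    rw [h]
    simp [Matrix.sum_apply, Matrix.vecMulVec_apply]
  rw [this]
  refine Matrix.PosSemidef.smul ?_ hc
  refine Matrix.posSemidef_sum _ fun g _ => ?_
  exact (Matrix.posSemidef_vecMulVec_self_star (u g)).smul (hw g)

theorem psd1 {n : ℕ} (Y : Finset (BX n)) :
    (∑ i ∈ range (n + 1), ∑ j ∈ range (n + 1), ∑ k ∈ range (n + 1),
        lam Y i j k • (Estar n i * Aham n j * Estar n k)).PosSemidef := by
  refine psd_aux _ _ (const_nonneg Y) (fun g => ind Y (g.1 0)) (fun g => ind_nonneg _ _)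
    (fun g x => ind Y (g.1 x)) fun x y => ?_
  rw [entry n (lam Y), hammingDist_comm x 0, lam_eq]
  simp only [S, mul_assoc]

theorem psd2 {n : ℕ} (Y : Finset (BX n)) :
    (∑ i ∈ range (n + 1), ∑ j ∈ range (n + 1), ∑ k ∈ range (n + 1),
        (lam Y 0 j j - lam Y i j k) • (Estar n i * Aham n j * Estar n k)).PosSemidef := by
  refine psd_aux _ _ (const_nonneg Y) (fun g => 1 - ind Y (g.1 0))
    (fun g => sub_nonneg.2 (ind_le _ _))
    (fun g x => ind Y (g.1 x)) fun x y => ?_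
  rw [entry n (fun i j k => lam Y 0 j j - lam Y i j k), hammingDist_comm x 0, lam_eq, lam_eq0,
    ← mul_sub, S, ← Finset.sum_sub_distrib]
  congr 1
  refine Finset.sum_congr rfl fun g _ => ?_
  ring

theorem NT_zero {n : ℕ} (Y : Finset (BX n)) : NT Y 0 0 0 = #Y := by
  unfold NT
  refine Finset.card_nbij' (fun t => t.1) (fun y => (y, y, y)) ?_ ?_ ?_ ?_
  · rintro ⟨a, b, c⟩ h
    simp only [Finset.coe_filter, Finset.mem_product, Set.mem_ofPred_eq] at h
    exact h.1.1
  · intro y hy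
    simpa using hy
  · rintro ⟨a, b, c⟩ h
    simp only [Finset.coe_filter, Finset.mem_product, Set.mem_ofPred_eq, hammingDist_eq_zero] at h
    obtain ⟨-, rfl, rfl, -⟩ := h
    rfl
  · intro y _; rfl

theorem lam_zero {n : ℕ} (Y : Finset (BX n)) (hY : Y.Nonempty) : lam Y 0 0 0 = 1 := by
  unfold lam
  rw [NT_zero, NT_zero]
  have h1 : (#Y : ℝ) ≠ 0 := by exact_mod_cast hY.card_pos.ne'
  have h2 : #(Finset.univ : Finset (BX n)) = 2 ^ n := by simp
  rw [h2, if_pos (by positivity)]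
  push_cast
  field_simp

theorem lam_dist {n : ℕ} (Y : Finset (BX n)) (δ : ℕ)
    (h : ∀ y ∈ Y, ∀ y' ∈ Y, y ≠ y' → δ ≤ hammingDist y y') (i j k : ℕ)
    (hd : (1 ≤ i ∧ i ≤ δ - 1) ∨ (1 ≤ j ∧ j ≤ δ - 1) ∨ (1 ≤ k ∧ k ≤ δ - 1)) :
    lam Y i j k = 0 := by
  have h' : ∀ y ∈ Y, ∀ y' ∈ Y, ¬ (1 ≤ hammingDist y y' ∧ hammingDist y y' ≤ δ - 1) := by
    rintro y hy y' hy' ⟨h1, h2⟩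
    have hne : y ≠ y' := by
      rintro rfl
      simp at h1
    have := h y hy y' hy' hne
    omega
  have : NT Y i j k = 0 := by
    unfold NT
    rw [Finset.card_eq_zero, Finset.filter_eq_empty_iff]
    rintro ⟨a, b, c⟩ ht ⟨rfl, rfl, rfl⟩
    simp only [Finset.mem_product] at ht
    obtain ⟨ha, hb, hc⟩ := ht
    rcases hd with hd | hd | hd
    · exact h' _ ha _ hb hd
    · exact h' _ hb _ hc hd
    · exact h' _ hc _ ha hd
  simp [lam, this]

theorem card_sphere (n i : ℕ) : #{x : BX n | hammingDist 0 x = i} = n.choose i := by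
  have : n.choose i = #(Finset.powersetCard i (Finset.univ : Finset (Fin n))) := by simp
  rw [this]
  refine Finset.card_nbij' (fun x => Finset.univ.filter fun l => 0 ≠ x l)
    (fun s l => if l ∈ s then 1 else 0) ?_ ?_ ?_ ?_
  · intro x hx
    simpa [hammingDist, Finset.mem_powersetCard] using hx
  · intro s hs
    simpa [hammingDist, Finset.mem_powersetCard] using hs
  · intro x _
    funext l
    have aux : ∀ u : Fin 2, (if 0 ≠ u then (1 : Fin 2) else 0) = u := by decide
    simpa using aux (x l)
  · intro s _
    ext l
    simp

theorem obj {n : ℕ} (Y : Finset (BX n)) (hY : Y.Nonempty) :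
    ∑ i ∈ range (n + 1), (n.choose i : ℝ) * lam Y 0 i i = Y.card := by
  have hle : ∀ v ∈ (Finset.univ : Finset (BX n)), hammingDist 0 v ∈ range (n + 1) := by
    intro v _
    have := hammingDist_le_card_fintype (x := (0 : BX n)) (y := v)
    simp only [Fintype.card_fin] at this
    exact Finset.mem_range.2 (by omega)
  have h1 : ∑ i ∈ range (n + 1), (n.choose i : ℝ) * lam Y 0 i i
      = ∑ x : BX n, lam Y 0 (hammingDist 0 x) (hammingDist 0 x) := by
    rw [← Finset.sum_fiberwise_of_maps_to hle]
    refine Finset.sum_congr rfl fun i _ => ?_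
    rw [← card_sphere, ← nsmul_eq_mul, ← Finset.sum_const]
    refine Finset.sum_congr rfl fun x hx => ?_
    rw [(Finset.mem_filter.1 hx).2]
  have h2 : ∀ g : Iso n, ∑ x : BX n, ind Y (g.1 x) = #Y := by
    intro g
    rw [Equiv.sum_comp g.1 (ind Y)]
    simp [ind]
  have h3 := lam_zero Y hY
  have h4 := lam_eq0 Y 0 0
  rw [hammingDist_self, h3] at h4
  simp only [ind_sq] at h4
  rw [h1]
  simp only [lam_eq0]
  rw [← Finset.mul_sum, Finset.sum_comm]
  simp only [← Finset.mul_sum, h2]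
  rw [← Finset.sum_mul, ← mul_assoc, ← h4, one_mul]

/-- Schrijver's SDP bound: the variables `λ_{ijk}` of a nonempty binary
code `Y` satisfy constraints (i)–(v) of Schrijver's semidefinite program and the
objective identity (vi); consequently every binary code of length `n` and minimum
distance at least `δ` has size at most the optimum of this program. -/
theorem schrijver_sdp_bound (n : ℕ) (hn : 1 ≤ n) (Y : Finset (BX n)) (hY : Y.Nonempty) :
    -- (i)
    lam Y 0 0 0 = 1 ∧
    -- (ii)
    (∀ i j k, i ≤ n → j ≤ n → k ≤ n → 0 ≤ lam Y i j k ∧ lam Y i j k ≤ lam Y 0 j j) ∧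
    -- (iii)
    (∀ i j k, lam Y i j k = lam Y j i k ∧ lam Y i j k = lam Y i k j) ∧
    -- (iv)
    (∑ i ∈ range (n + 1), ∑ j ∈ range (n + 1), ∑ k ∈ range (n + 1),
        lam Y i j k • (Estar n i * Aham n j * Estar n k)).PosSemidef ∧
    (∑ i ∈ range (n + 1), ∑ j ∈ range (n + 1), ∑ k ∈ range (n + 1),
        (lam Y 0 j j - lam Y i j k) • (Estar n i * Aham n j * Estar n k)).PosSemidef ∧
    -- (v)
    (∀ δ : ℕ, (∀ y ∈ Y, ∀ y' ∈ Y, y ≠ y' → δ ≤ hammingDist y y') →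
      ∀ i j k, ((1 ≤ i ∧ i ≤ δ - 1) ∨ (1 ≤ j ∧ j ≤ δ - 1) ∨ (1 ≤ k ∧ k ≤ δ - 1)) →
        lam Y i j k = 0) ∧
    -- (vi)
    (∑ i ∈ range (n + 1), (n.choose i : ℝ) * lam Y 0 i i = Y.card) ∧
    -- consequence: the SDP bound
    (∀ (δ : ℕ) (Z : Finset (BX n)), Z.Nonempty →
      (∀ y ∈ Z, ∀ y' ∈ Z, y ≠ y' → δ ≤ hammingDist y y') →
      ∀ u : ℝ,
        (∀ μ : ℕ → ℕ → ℕ → ℝ, Feasible n δ μ →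
          ∑ i ∈ range (n + 1), (n.choose i : ℝ) * μ 0 i i ≤ u) →
        (Z.card : ℝ) ≤ u) := by
  refine ⟨lam_zero Y hY, fun i j k _ _ _ => ⟨lam_nonneg Y i j k, lam_le Y i j k⟩, lam_symm Y,
    psd1 Y, psd2 Y, fun δ h => lam_dist Y δ h, obj Y hY, ?_⟩
  intro δ Z hZ hd u hu
  rw [← obj Z hZ]
  exact hu (lam Z) ⟨lam_zero Z hZ, fun i j k _ _ _ => ⟨lam_nonneg Z i j k, lam_le Z i j k⟩,
    lam_symm Z, psd1 Z, psd2 Z, lam_dist Z δ hd⟩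

end SDPBound
end
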